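/- Let (Ω, F, P) be a probability space with filtration (F_s)_{s∈[0,T]} and let η : [0,T] × Ω → ℝ^{d×d} be jointly measurable and adapted, with values P-a.s. in the symmetric positive definite d×d matrices, such that: E[‖η_s‖] < ∞ for every s; E[η_s] is positive definite for every s; the function s ↦ ‖(E[η_s])⁻¹‖ is integrable on [0,T]; and the process M_s = η_s (E[η_s])⁻¹, s ∈ [0,T], is a martingale with respect to (F_s). Fix t ∈ [0,T) and x ∈ ℝ^d, set h_t = ∫_t^T (E[η_s])⁻¹ ds (a positive definite, hence invertible, matrix) and define the deterministic control u_s = (E[η_s])⁻¹ h_t⁻¹ x for s ∈ [t,T]. Then: (a) ∫_t^T u_s ds = x, so the state X_s = x − ∫_t^s u_r dr satisfies X_t = x and X_T = 0; and (b) P-a.s., E[∫_t^T ⟨u_s, η_s u_s⟩ ds | F_t] = ⟨x, η_t (E[η_t])⁻¹ h_t⁻¹ x⟩. -/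

import Mathlib

open MeasureTheory Matrix intervalIntegral

/-- The entrywise expectation `E[η_s]` of a matrix-valued process at time `s`. -/
noncomputable def Eeta {Ω : Type*} {mΩ : MeasurableSpace Ω} (μ : Measure Ω) {d : ℕ}
    (η : ℝ → Ω → Matrix (Fin d) (Fin d) ℝ) (s : ℝ) : Matrix (Fin d) (Fin d) ℝ :=
  Matrix.of fun i j => ∫ ω, η s ω i j ∂μ

/-- The matrix `h_t = ∫_t^T (E[η_s])⁻¹ ds` (entrywise integral). -/
noncomputable def hMat {Ω : Type*} {mΩ : MeasurableSpace Ω} (μ : Measure Ω) {d : ℕ}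
    (η : ℝ → Ω → Matrix (Fin d) (Fin d) ℝ) (t T : ℝ) : Matrix (Fin d) (Fin d) ℝ :=
  Matrix.of fun i j => ∫ s in t..T, (Eeta μ η s)⁻¹ i j

/-- The deterministic control `u_s = (E[η_s])⁻¹ h_t⁻¹ x`. -/
noncomputable def uCtrl {Ω : Type*} {mΩ : MeasurableSpace Ω} (μ : Measure Ω) {d : ℕ}
    (η : ℝ → Ω → Matrix (Fin d) (Fin d) ℝ) (t T : ℝ) (x : Fin d → ℝ) (s : ℝ) :
    Fin d → ℝ :=
  ((Eeta μ η s)⁻¹).mulVec ((hMat μ η t T)⁻¹.mulVec x)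

/-- A bilinear form in an entrywise integrable random matrix is integrable. -/
lemma integrable_dotProduct_mulVec {Ω n : Type*} [Fintype n] {mΩ : MeasurableSpace Ω}
    {ρ : Measure Ω} {N : Ω → Matrix n n ℝ} (hN : ∀ i j, Integrable (fun ω => N ω i j) ρ)
    (v w : n → ℝ) : Integrable (fun ω => v ⬝ᵥ (N ω).mulVec w) ρ := by
  simp only [dotProduct, mulVec]
  exact integrable_finsetSum _ fun i _ => (integrable_finsetSum _ fun j _ =>
    (hN i j).mul_const _).const_mul _

/-- The integral of a bilinear form is the bilinear form of the entrywise integral. -/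
lemma integral_dotProduct_mulVec {Ω n : Type*} [Fintype n] {mΩ : MeasurableSpace Ω}
    {ρ : Measure Ω} {N : Ω → Matrix n n ℝ} (hN : ∀ i j, Integrable (fun ω => N ω i j) ρ)
    (v w : n → ℝ) :
    ∫ ω, v ⬝ᵥ (N ω).mulVec w ∂ρ =
      v ⬝ᵥ (Matrix.of fun i j => ∫ ω, N ω i j ∂ρ).mulVec w := by
  simp only [dotProduct, mulVec, Matrix.of_apply]
  rw [integral_finsetSum _ fun i _ => (integrable_finsetSum _ fun j _ =>
    (hN i j).mul_const _).const_mul _]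
  refine Finset.sum_congr rfl fun i _ => ?_
  rw [MeasureTheory.integral_const_mul,
    integral_finsetSum _ fun j _ => (hN i j).mul_const _]
  simp only [MeasureTheory.integral_mul_const]

/-- Entrywise integrability is preserved by right multiplication by a constant matrix. -/
lemma integrable_matrix_mul_const {Ω n : Type*} [Fintype n] {mΩ : MeasurableSpace Ω}
    {ρ : Measure Ω} {N : Ω → Matrix n n ℝ} (hN : ∀ i j, Integrable (fun ω => N ω i j) ρ)
    (A : Matrix n n ℝ) (i j : n) : Integrable (fun ω => (N ω * A) i j) ρ := by
  simp only [Matrix.mul_apply]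
  exact integrable_finsetSum _ fun k _ => (hN i k).mul_const _

/-- The integral of an almost everywhere positive definite matrix function over a set of positive
measure is invertible. -/
lemma isUnit_det_integral_of_posDef {S n : Type*} [Fintype n] [DecidableEq n]
    {mS : MeasurableSpace S} {ν : Measure S} [NeZero ν] {N : S → Matrix n n ℝ}
    (hN : ∀ i j, Integrable (fun s => N s i j) ν) (hpd : ∀ᵐ s ∂ν, (N s).PosDef) :
    IsUnit (Matrix.of fun i j => ∫ s, N s i j ∂ν).det := by
  rw [isUnit_iff_ne_zero]
  intro h0
  obtain ⟨v, hv, hv0⟩ := Matrix.exists_mulVec_eq_zero_iff.mpr h0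
  have h1 := integral_dotProduct_mulVec hN v v
  rw [hv0, dotProduct_zero, integral_eq_zero_iff_of_nonneg_ae _
    (integrable_dotProduct_mulVec hN v v)] at h1
  · obtain ⟨s, hs, hs0⟩ := (hpd.and h1).exists
    have := hs.dotProduct_mulVec_pos hv
    simp only [star_trivial] at this
    exact this.ne' hs0
  · filter_upwards [hpd] with s hs
    simpa using hs.posSemidef.dotProduct_mulVec_nonneg v

/-- For a process `η` with uncorrelated multiplicative increments (expressed via the
martingale property of `M_s = η_s (E[η_s])⁻¹`), the deterministic control
`u_s = (E[η_s])⁻¹ h_t⁻¹ x` fully liquidates the position `x` over `[t,T]`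
(`∫_t^T u_s ds = x`, so the state `X_s = x − ∫_t^s u_r dr` has `X_t = x`, `X_T = 0`),
and its conditional expected cost is
`E[∫_t^T ⟨u_s, η_s u_s⟩ ds | F_t] = ⟨x, η_t (E[η_t])⁻¹ h_t⁻¹ x⟩` a.s. -/
theorem stmt12 {Ω : Type*} {m : MeasurableSpace Ω} (μ : Measure Ω) [IsProbabilityMeasure μ]
    {d : ℕ} {T : ℝ} (hT : 0 < T)
    (𝓕 : Filtration ℝ m)
    (η : ℝ → Ω → Matrix (Fin d) (Fin d) ℝ)
    (hjm : ∀ i j, Measurable fun p : ℝ × Ω => η p.1 p.2 i j)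
    (hadp : ∀ s i j, Measurable[𝓕 s] fun ω => η s ω i j)
    (hpd : ∀ s ∈ Set.Icc (0 : ℝ) T, ∀ᵐ ω ∂μ, (η s ω).PosDef)
    (hint : ∀ s ∈ Set.Icc (0 : ℝ) T, ∀ i j, Integrable (fun ω => η s ω i j) μ)
    (hEpd : ∀ s ∈ Set.Icc (0 : ℝ) T, (Eeta μ η s).PosDef)
    (hinvint : ∀ i j, IntegrableOn (fun s => (Eeta μ η s)⁻¹ i j) (Set.Icc (0 : ℝ) T))
    (hmart : ∀ s t' : ℝ, 0 ≤ s → s ≤ t' → t' ≤ T → ∀ i j,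
      μ[(fun ω => (η t' ω * (Eeta μ η t')⁻¹) i j)|𝓕 s]
        =ᵐ[μ] fun ω => (η s ω * (Eeta μ η s)⁻¹) i j)
    (t : ℝ) (ht : 0 ≤ t) (htT : t < T) (x : Fin d → ℝ) :
    ((∀ i, (∫ s in t..T, uCtrl μ η t T x s i) = x i) ∧
      (fun i => x i - ∫ r in t..t, uCtrl μ η t T x r i) = x ∧
      (fun i => x i - ∫ r in t..T, uCtrl μ η t T x r i) = 0) ∧
    (μ[(fun ω => ∫ s in t..T, uCtrl μ η t T x s ⬝ᵥ (η s ω).mulVec (uCtrl μ η t T x s))|𝓕 t]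
      =ᵐ[μ] fun ω => x ⬝ᵥ (η t ω * (Eeta μ η t)⁻¹ * (hMat μ η t T)⁻¹).mulVec x) := by
  have hsub : Set.Ioc t T ⊆ Set.Icc 0 T := fun s hs => ⟨ht.trans hs.1.le, hs.2⟩
  have htm : t ∈ Set.Icc 0 T := ⟨ht, htT.le⟩
  set ν := (volume : Measure ℝ).restrict (Set.Ioc t T) with hν
  have hνmem : ∀ᵐ s ∂ν, s ∈ Set.Ioc t T := ae_restrict_mem measurableSet_Ioc
  have hνne : NeZero ν := ⟨by
    rw [hν, Ne, Measure.restrict_eq_zero, Real.volume_Ioc, ENNReal.ofReal_eq_zero]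
    linarith⟩
  have hAint : ∀ i j, Integrable (fun s => (Eeta μ η s)⁻¹ i j) ν :=
    fun i j => (hinvint i j).mono_set hsub
  have hh : hMat μ η t T = Matrix.of fun i j => ∫ s, (Eeta μ η s)⁻¹ i j ∂ν := by
    ext i j
    simp only [hMat, Matrix.of_apply, integral_of_le htT.le, hν]
  have hhdet : IsUnit (hMat μ η t T).det := by
    rw [hh]
    refine isUnit_det_integral_of_posDef hAint ?_
    filter_upwards [hνmem] with s hs using (hEpd s (hsub hs)).inv
  set y := (hMat μ η t T)⁻¹.mulVec x with hy
  have hhy : (hMat μ η t T).mulVec y = x := by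
    rw [hy, mulVec_mulVec, Matrix.mul_nonsing_inv _ hhdet, one_mulVec]
  have huint : ∀ i, Integrable (fun s => uCtrl μ η t T x s i) ν := fun i => by
    simp only [uCtrl, mulVec, dotProduct]
    exact integrable_finsetSum _ fun j _ => (hAint i j).mul_const _
  have hu : ∀ i, ∫ s, uCtrl μ η t T x s i ∂ν = x i := fun i => by
    conv_rhs => rw [← hhy, hh]
    simp only [uCtrl, mulVec, dotProduct, Matrix.of_apply]
    rw [integral_finsetSum _ fun j _ => (hAint i j).mul_const _]
    simp only [MeasureTheory.integral_mul_const]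
    rfl
  have hu' : ∀ i, (∫ s in t..T, uCtrl μ η t T x s i) = x i := fun i => by
    rw [integral_of_le htT.le, hu i]
  have hudot : ∀ c : Fin d → ℝ, ∫ s, uCtrl μ η t T x s ⬝ᵥ c ∂ν = x ⬝ᵥ c := fun c => by
    simp only [dotProduct]
    rw [integral_finsetSum _ fun j _ => (huint j).mul_const _]
    simp only [MeasureTheory.integral_mul_const, hu]
  refine ⟨⟨hu', by simp, by ext i; simp [hu']⟩, ?_⟩
  set g : ℝ × Ω → ℝ := fun p =>
    uCtrl μ η t T x p.1 ⬝ᵥ (η p.1 p.2).mulVec (uCtrl μ η t T x p.1) with hg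
  have hgmeas : AEStronglyMeasurable g (ν.prod μ) := by
    simp only [hg, dotProduct, mulVec]
    have huc : ∀ i, AEStronglyMeasurable (fun p : ℝ × Ω => uCtrl μ η t T x p.1 i) (ν.prod μ) :=
      fun i => (huint i).aestronglyMeasurable.comp_fst
    refine Finset.aestronglyMeasurable_fun_sum _ fun i _ => (huc i).mul ?_
    exact Finset.aestronglyMeasurable_fun_sum _ fun j _ =>
      (hjm i j).aestronglyMeasurable.mul (huc j)
  have hEu : ∀ s ∈ Set.Ioc t T, (Eeta μ η s).mulVec (uCtrl μ η t T x s) = y := fun s hs => by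
    rw [uCtrl, mulVec_mulVec, Matrix.mul_nonsing_inv _
      ((Matrix.isUnit_iff_isUnit_det _).mp (hEpd s (hsub hs)).isUnit), one_mulVec]
  have hgint : Integrable g (ν.prod μ) := by
    rw [integrable_prod_iff hgmeas]
    constructor
    · filter_upwards [hνmem] with s hs
      exact integrable_dotProduct_mulVec (hint s (hsub hs)) (uCtrl μ η t T x s)
        (uCtrl μ η t T x s)
    · have hI : Integrable (fun s => uCtrl μ η t T x s ⬝ᵥ y) ν := by
        simp only [dotProduct]
        exact integrable_finsetSum _ fun j _ => (huint j).mul_const _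
      refine hI.congr ?_
      filter_upwards [hνmem] with s hs
      rw [← hEu s hs, Eeta, ← integral_dotProduct_mulVec (hint s (hsub hs))]
      refine integral_congr_ae ?_
      filter_upwards [hpd s (hsub hs)] with ω hω
      rw [Real.norm_of_nonneg]
      simpa using hω.posSemidef.dotProduct_mulVec_nonneg (uCtrl μ η t T x s)
  have hMint : ∀ s ∈ Set.Icc 0 T, ∀ i j,
      Integrable (fun ω => (η s ω * (Eeta μ η s)⁻¹) i j) μ :=
    fun s hs => integrable_matrix_mul_const (hint s hs) _
  have hrhs : (fun ω => x ⬝ᵥ (η t ω * (Eeta μ η t)⁻¹ * (hMat μ η t T)⁻¹).mulVec x) =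
      fun ω => x ⬝ᵥ (η t ω * (Eeta μ η t)⁻¹).mulVec y := by
    ext ω
    rw [hy, mulVec_mulVec]
  have hrint := integrable_dotProduct_mulVec (hMint t htm) x y
  have hlhs : (fun ω => ∫ s in t..T,
      uCtrl μ η t T x s ⬝ᵥ (η s ω).mulVec (uCtrl μ η t T x s)) =
      fun ω => ∫ s, g (s, ω) ∂ν := by
    ext ω
    rw [integral_of_le htT.le]
  rw [hrhs, hlhs]
  symm
  refine ae_eq_condExp_of_forall_setIntegral_eq (𝓕.le t) hgint.integral_prod_right
    (fun B _ _ => hrint.integrableOn) (fun B hB _ => ?_) ?_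
  · have hgB : Integrable (Function.uncurry fun ω s => g (s, ω)) ((μ.restrict B).prod ν) := by
      refine hgint.swap.mono_measure ?_
      exact Measure.prod_mono Measure.restrict_le_self le_rfl
    rw [MeasureTheory.integral_integral_swap hgB,
      integral_dotProduct_mulVec fun i j => (hMint t htm i j).integrableOn, ← hudot]
    refine integral_congr_ae ?_
    filter_upwards [hνmem] with s hs
    have hfac : ∀ ω, g (s, ω) =
        uCtrl μ η t T x s ⬝ᵥ (η s ω * (Eeta μ η s)⁻¹).mulVec y := fun ω => by
      rw [← mulVec_mulVec]
      rfl
    simp only [hfac]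
    rw [integral_dotProduct_mulVec fun i j => (hMint s (hsub hs) i j).integrableOn]
    congr 3
    ext i j
    rw [← setIntegral_condExp (𝓕.le t) (hMint s (hsub hs) i j) hB]
    exact setIntegral_congr_ae (𝓕.le t _ hB)
      ((hmart t s ht hs.1.le hs.2 i j).mono fun ω h _ => h.symm)
  · refine StronglyMeasurable.aestronglyMeasurable (Measurable.stronglyMeasurable ?_)
    simp only [dotProduct, mulVec, Matrix.mul_apply]
    refine Finset.measurable_fun_sum _ fun i _ => Measurable.const_mul ?_ _
    refine Finset.measurable_fun_sum _ fun j _ => Measurable.mul_const ?_ _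
    exact Finset.measurable_fun_sum _ fun k _ => (hadp t i k).mul_const _
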